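/- Let U ⊆ ℂ be open, Ω : U → h twice continuously differentiable, and c_i, d_i ∈ ℂ nonzero constants with k_i = c_i·d_i. Define g-valued functions on U by A_z = −∂_z Ω + Σ_{i=0}^l c_i·e^{α_i(Ω)}·e_{−α_i} (which equals −∂_z Ω + Ad_{exp(−Ω)}(Σ_i c_i e_{−α_i})) and A_z̄ = ∂_z̄ Ω + Σ_{i=0}^l d_i·e^{α_i(Ω)}·e_{α_i} (which equals ∂_z̄ Ω + Ad_{exp(Ω)}(Σ_i d_i e_{α_i})). Then the zero-curvature equation ∂_z A_z̄ − ∂_z̄ A_z + ⁅A_z, A_z̄⁆ = 0 holds on U if and only if Ω satisfies the affine Toda equation 2·∂_z∂_z̄ Ω = Σ_{i=0}^l k_i·e^{2α_i(Ω)}·h_i on U. -/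

import Mathlib

open Complex

/-- The Wirtinger derivative `∂_z f` of a function `f : ℂ → L`. -/
noncomputable def wirtingerDz {L : Type*} [NormedAddCommGroup L] [NormedSpace ℂ L]
    (f : ℂ → L) (w : ℂ) : L :=
  (2⁻¹ : ℂ) • (fderiv ℝ f w 1 - Complex.I • fderiv ℝ f w Complex.I)

/-- The Wirtinger derivative `∂_z̄ f` of a function `f : ℂ → L`. -/
noncomputable def wirtingerDzbar {L : Type*} [NormedAddCommGroup L] [NormedSpace ℂ L]
    (f : ℂ → L) (w : ℂ) : L :=
  (2⁻¹ : ℂ) • (fderiv ℝ f w 1 + Complex.I • fderiv ℝ f w Complex.I)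

theorem aux_mem {L : Type*} [NormedAddCommGroup L] [NormedSpace ℂ L] [FiniteDimensional ℂ L]
    (hSub : Submodule ℂ L) (U : Set ℂ) (hU : IsOpen U) (Ω : ℂ → L)
    (hΩmem : ∀ w ∈ U, Ω w ∈ hSub) (w : ℂ) (hw : w ∈ U) (hd : DifferentiableAt ℝ Ω w) (v : ℂ) :
    fderiv ℝ Ω w v ∈ hSub := by
  obtain ⟨p, hp⟩ := hSub.subtype.exists_leftInverse_of_injective (by simp)
  let P : L →L[ℂ] L := LinearMap.toContinuousLinearMap (hSub.subtype ∘ₗ p)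
  have hev : Ω =ᶠ[nhds w] fun z => P (Ω z) := by
    filter_upwards [hU.mem_nhds hw] with z hz
    have := LinearMap.congr_fun hp ⟨Ω z, hΩmem z hz⟩
    simp at this
    simp [P, this]
  have h1 : HasFDerivAt (fun z => P (Ω z)) ((P.restrictScalars ℝ).comp (fderiv ℝ Ω w)) w :=
    (P.restrictScalars ℝ).hasFDerivAt.comp w hd.hasFDerivAt
  have h2 := (h1.congr_of_eventuallyEq hev).fderiv
  rw [h2]
  simp [P]

theorem aux_sum {L : Type*} [NormedAddCommGroup L] [NormedSpace ℂ L] [FiniteDimensional ℂ L]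
    {ι : Type*} [Fintype ι] (a : ι → (L →ₗ[ℂ] ℂ)) (c : ι → ℂ) (e : ι → L)
    (Ω : ℂ → L) (w : ℂ) (hd : DifferentiableAt ℝ Ω w) :
    ∃ F : ℂ →L[ℝ] L, HasFDerivAt (fun z => ∑ i, (c i * Complex.exp (a i (Ω z))) • e i) F w ∧
      ∀ v, F v = ∑ i, (c i * Complex.exp (a i (Ω w)) * a i (fderiv ℝ Ω w v)) • e i := by
  have h1 : ∀ i, HasFDerivAt (fun z => a i (Ω z))
      (((LinearMap.toContinuousLinearMap (a i)).restrictScalars ℝ).comp (fderiv ℝ Ω w)) w :=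
    fun i => ((LinearMap.toContinuousLinearMap (a i)).restrictScalars ℝ).hasFDerivAt.comp w
      hd.hasFDerivAt
  have h2 := fun i => (((h1 i).cexp).const_mul (c i)).smul_const (e i)
  refine ⟨_, HasFDerivAt.fun_sum (fun i _ => h2 i), ?_⟩
  intro v
  simp [ContinuousLinearMap.sum_apply, mul_assoc]

theorem aux_dz {L : Type*} [NormedAddCommGroup L] [NormedSpace ℂ L]
    (f : ℂ → L) (F : ℂ →L[ℝ] L) (w : ℂ) (h : HasFDerivAt f F w) :
    wirtingerDz f w = (2⁻¹ : ℂ) • (F 1 - Complex.I • F Complex.I) := by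
  rw [wirtingerDz, h.fderiv]

theorem aux_dzbar {L : Type*} [NormedAddCommGroup L] [NormedSpace ℂ L]
    (f : ℂ → L) (F : ℂ →L[ℝ] L) (w : ℂ) (h : HasFDerivAt f F w) :
    wirtingerDzbar f w = (2⁻¹ : ℂ) • (F 1 + Complex.I • F Complex.I) := by
  rw [wirtingerDzbar, h.fderiv]

theorem aux_second {L : Type*} [NormedAddCommGroup L] [NormedSpace ℂ L]
    (Ω : ℂ → L) (w : ℂ) (h : ContDiffAt ℝ 2 Ω w) :
    DifferentiableAt ℝ (wirtingerDz Ω) w ∧ DifferentiableAt ℝ (wirtingerDzbar Ω) w ∧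
    wirtingerDzbar (wirtingerDz Ω) w = wirtingerDz (wirtingerDzbar Ω) w := by
  have hD : DifferentiableAt ℝ (fderiv ℝ Ω) w :=
    (h.fderiv_right (m := 1) (by norm_num)).differentiableAt (by norm_num)
  have hs : IsSymmSndFDerivAt ℝ Ω w := h.isSymmSndFDerivAt (by simp)
  have hv : ∀ v, HasFDerivAt (fun z => fderiv ℝ Ω z v)
      ((fderiv ℝ (fderiv ℝ Ω) w).flip v) w := fun v => by
    have := hD.hasFDerivAt.clm_apply (hasFDerivAt_const v w)
    simpa using this
  have k1 : HasFDerivAt (wirtingerDz Ω) _ w :=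
    ((hv 1).sub ((hv Complex.I).const_smul Complex.I)).const_smul (2⁻¹ : ℂ)
  have k2 : HasFDerivAt (wirtingerDzbar Ω) _ w :=
    ((hv 1).add ((hv Complex.I).const_smul Complex.I)).const_smul (2⁻¹ : ℂ)
  refine ⟨k1.differentiableAt, k2.differentiableAt, ?_⟩
  rw [aux_dz _ _ _ k2, aux_dzbar _ _ _ k1]
  have := hs.eq 1 Complex.I
  simp [this]
  module

/-- Let `g` be a complex Lie algebra (bracket `B`) with abelian subalgebra
`hSub`, functionals `a i` and elements `hvec i ∈ hSub`, `e i, eneg i` satisfying the affine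
root relations, and nonzero constants `c i, d i` with `k i = c i * d i`.  For a twice
continuously differentiable `Ω : U → hSub` define
`Az = −∂_z Ω + ∑ i, c i·e^{α_i(Ω)} • eneg i` and `Azbar = ∂_z̄ Ω + ∑ i, d i·e^{α_i(Ω)} • e i`.
Then the zero-curvature equation `∂_z Azbar − ∂_z̄ Az + ⁅Az, Azbar⁆ = 0` holds on `U` if and
only if `Ω` satisfies the affine Toda equation `2 ∂_z ∂_z̄ Ω = ∑ i, k i·e^{2 α_i(Ω)} • hvec i`
on `U`. -/
theorem zero_curvature_iff_affine_toda
    {L : Type*} [NormedAddCommGroup L] [NormedSpace ℂ L] [FiniteDimensional ℂ L]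
    {ι : Type*} [Fintype ι] [DecidableEq ι]
    (B : L →ₗ[ℂ] L →ₗ[ℂ] L)
    (halt : ∀ u, B u u = 0)
    (hjac : ∀ u v w, B u (B v w) = B (B u v) w + B v (B u w))
    (hSub : Submodule ℂ L)
    (habelian : ∀ H₁ ∈ hSub, ∀ H₂ ∈ hSub, B H₁ H₂ = 0)
    (a : ι → (L →ₗ[ℂ] ℂ)) (hvec : ι → L) (e eneg : ι → L)
    (hmem : ∀ i, hvec i ∈ hSub)
    (he : ∀ H ∈ hSub, ∀ i, B H (e i) = a i H • e i)
    (heneg : ∀ H ∈ hSub, ∀ i, B H (eneg i) = -(a i H) • eneg i)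
    (hee : ∀ i j, B (e i) (eneg j) = if i = j then hvec i else 0)
    (c d k : ι → ℂ) (hc : ∀ i, c i ≠ 0) (hd : ∀ i, d i ≠ 0)
    (hk : ∀ i, k i = c i * d i)
    (U : Set ℂ) (hU : IsOpen U)
    (Ω : ℂ → L) (hΩ : ContDiffOn ℝ 2 Ω U)
    (hΩmem : ∀ w ∈ U, Ω w ∈ hSub)
    (Az Azbar : ℂ → L)
    (hAz : ∀ w, Az w = -(wirtingerDz Ω w) +
      ∑ i, (c i * Complex.exp (a i (Ω w))) • eneg i)
    (hAzbar : ∀ w, Azbar w = wirtingerDzbar Ω w +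
      ∑ i, (d i * Complex.exp (a i (Ω w))) • e i) :
    (∀ w ∈ U, wirtingerDz Azbar w - wirtingerDzbar Az w + B (Az w) (Azbar w) = 0) ↔
    (∀ w ∈ U, (2 : ℂ) • wirtingerDz (fun z => wirtingerDzbar Ω z) w =
      ∑ i, (k i * Complex.exp (2 * a i (Ω w))) • hvec i) := by
  refine forall₂_congr fun w hw => ?_
  have hC : ContDiffAt ℝ 2 Ω w := hΩ.contDiffAt (hU.mem_nhds hw)
  have hd1 : DifferentiableAt ℝ Ω w := hC.differentiableAt (by norm_num)
  obtain ⟨s1, s2, s3⟩ := aux_second Ω w hC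
  obtain ⟨F, hF, hF'⟩ := aux_sum a c eneg Ω w hd1
  obtain ⟨G, hG, hG'⟩ := aux_sum a d e Ω w hd1
  have hm := aux_mem hSub U hU Ω hΩmem w hw hd1
  have m1 : wirtingerDz Ω w ∈ hSub :=
    hSub.smul_mem _ (hSub.sub_mem (hm _) (hSub.smul_mem _ (hm _)))
  have m2 : wirtingerDzbar Ω w ∈ hSub :=
    hSub.smul_mem _ (hSub.add_mem (hm _) (hSub.smul_mem _ (hm _)))
  have hskew : ∀ u v, B u v = -B v u := fun u v => by
    have := halt (u + v)
    simp [halt] at this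
    exact eq_neg_of_add_eq_zero_left this
  have e1 : wirtingerDz Azbar w = wirtingerDz (wirtingerDzbar Ω) w +
      ∑ i, (d i * Complex.exp (a i (Ω w)) * a i (wirtingerDz Ω w)) • e i := by
    have : HasFDerivAt Azbar (fderiv ℝ (wirtingerDzbar Ω) w + G) w := by
      rw [funext hAzbar]; exact s2.hasFDerivAt.add hG
    rw [aux_dz _ _ _ this, wirtingerDz, wirtingerDz]
    simp only [ContinuousLinearMap.add_apply, hG']
    have : ∑ i, (d i * Complex.exp (a i (Ω w)) * a i ((2⁻¹ : ℂ) • (fderiv ℝ Ω w 1 -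
        Complex.I • fderiv ℝ Ω w Complex.I))) • e i = (2⁻¹ : ℂ) •
        (∑ i, (d i * Complex.exp (a i (Ω w)) * a i (fderiv ℝ Ω w 1)) • e i - Complex.I •
          ∑ i, (d i * Complex.exp (a i (Ω w)) * a i (fderiv ℝ Ω w Complex.I)) • e i) := by
      simp only [Finset.smul_sum, ← Finset.sum_sub_distrib]
      refine Finset.sum_congr rfl fun i _ => ?_
      simp only [map_smul, map_sub, smul_eq_mul]
      module
    rw [this]
    module
  have e2 : wirtingerDzbar Az w = -wirtingerDz (wirtingerDzbar Ω) w +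
      ∑ i, (c i * Complex.exp (a i (Ω w)) * a i (wirtingerDzbar Ω w)) • eneg i := by
    have : HasFDerivAt Az (-fderiv ℝ (wirtingerDz Ω) w + F) w := by
      rw [funext hAz]; exact s1.hasFDerivAt.neg.add hF
    rw [← s3, aux_dzbar _ _ _ this, wirtingerDzbar, wirtingerDzbar]
    simp only [ContinuousLinearMap.add_apply, ContinuousLinearMap.neg_apply, hF']
    have : ∑ i, (c i * Complex.exp (a i (Ω w)) * a i ((2⁻¹ : ℂ) • (fderiv ℝ Ω w 1 +
        Complex.I • fderiv ℝ Ω w Complex.I))) • eneg i = (2⁻¹ : ℂ) •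
        (∑ i, (c i * Complex.exp (a i (Ω w)) * a i (fderiv ℝ Ω w 1)) • eneg i + Complex.I •
          ∑ i, (c i * Complex.exp (a i (Ω w)) * a i (fderiv ℝ Ω w Complex.I)) • eneg i) := by
      simp only [Finset.smul_sum, ← Finset.sum_add_distrib]
      refine Finset.sum_congr rfl fun i _ => ?_
      simp only [map_smul, map_add, smul_eq_mul]
      module
    rw [this]
    module
  have b1 : B (wirtingerDz Ω w) (∑ i, (d i * Complex.exp (a i (Ω w))) • e i) =
      ∑ i, (d i * Complex.exp (a i (Ω w)) * a i (wirtingerDz Ω w)) • e i := by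
    simp only [map_sum, map_smul, he _ m1, smul_smul]
  have b2 : B (∑ i, (c i * Complex.exp (a i (Ω w))) • eneg i) (wirtingerDzbar Ω w) =
      ∑ i, (c i * Complex.exp (a i (Ω w)) * a i (wirtingerDzbar Ω w)) • eneg i := by
    rw [hskew]
    simp only [map_sum, map_smul, heneg _ m2, smul_smul, ← Finset.sum_neg_distrib]
    refine Finset.sum_congr rfl fun i _ => ?_
    module
  have b3 : B (∑ i, (c i * Complex.exp (a i (Ω w))) • eneg i)
      (∑ i, (d i * Complex.exp (a i (Ω w))) • e i) =
      -∑ i, (k i * Complex.exp (2 * a i (Ω w))) • hvec i := by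
    rw [hskew]
    simp only [map_sum, map_smul, LinearMap.sum_apply, LinearMap.smul_apply, hee, smul_ite,
      smul_zero, Finset.sum_ite_eq, Finset.sum_ite_eq', Finset.mem_univ, if_true]
    congr 1
    refine Finset.sum_congr rfl fun i _ => ?_
    rw [hk, two_mul, Complex.exp_add]
    module
  have key : wirtingerDz Azbar w - wirtingerDzbar Az w + B (Az w) (Azbar w) =
      (2 : ℂ) • wirtingerDz (fun z => wirtingerDzbar Ω z) w -
      ∑ i, (k i * Complex.exp (2 * a i (Ω w))) • hvec i := by
    rw [e1, e2, hAz, hAzbar]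
    simp only [map_add, map_neg, LinearMap.add_apply, LinearMap.neg_apply]
    rw [b1, b2, b3, habelian _ m1 _ m2]
    module
  rw [key, sub_eq_zero]
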